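/- Let X be a topological space, f : X → X a continuous map, U₁, U₂ ⊆ X open sets with U₁ ∩ U₂ = ∅, and B ⊆ X a set with f(U₁) ⊆ U₁ ∪ B, f(U₂) ⊆ U₂ ∪ B, f(B) ⊆ B, and B ∩ (U₁ ∪ U₂) = ∅. Let K ⊆ X be a connected (preconnected) subset such that for every x ∈ K there exists an integer n ≥ 1 with fⁿ(x) ∈ U₁ ∪ U₂. Then either fⁿ(x) ∉ U₂ for every x ∈ K and every n ≥ 1, or fⁿ(x) ∉ U₁ for every x ∈ K and every n ≥ 1. -/

import Mathlib

/-- Once an orbit enters a forward-invariant set, it avoids every set disjoint from it. -/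
theorem Set.MapsTo.iterate_notMem_of_le {X : Type*} {f : X → X} {S V : Set X}
    (hS : Set.MapsTo f S S) (hSV : Disjoint S V) {x : X} {m n : ℕ} (hmn : m ≤ n)
    (hx : f^[m] x ∈ S) : f^[n] x ∉ V := by
  obtain ⟨k, rfl⟩ := Nat.exists_eq_add_of_le' hmn
  rw [Function.iterate_add_apply]
  exact hSV.notMem_of_mem_left (hS.iterate k hx)

/-- The set of points some positive iterate of which lies in an open set is open. -/
theorem Continuous.isOpen_setOf_exists_iterate_mem {X : Type*} [TopologicalSpace X] {f : X → X}
    (hf : Continuous f) {U : Set X} (hU : IsOpen U) :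
    IsOpen {x | ∃ n : ℕ, 1 ≤ n ∧ f^[n] x ∈ U} := by
  simp only [Set.ofPred_exists, Set.ofPred_and]
  exact isOpen_iUnion fun n => isOpen_const.inter (hU.preimage (hf.iterate n))

/-- **First-hit dichotomy for connected sets.**
Let `f : X → X` be continuous, `U₁, U₂` disjoint open sets, and `B` a set with
`f(U₁) ⊆ U₁ ∪ B`, `f(U₂) ⊆ U₂ ∪ B`, `f(B) ⊆ B`, `B ∩ (U₁ ∪ U₂) = ∅`.
If `K` is a connected (preconnected) set every point of which eventually enters `U₁ ∪ U₂`
under some iterate `fⁿ` with `n ≥ 1`, then either no forward iterate (with `n ≥ 1`) of a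
point of `K` lies in `U₂`, or no forward iterate (with `n ≥ 1`) of a point of `K` lies
in `U₁`. -/
theorem stmt3 {X : Type*} [TopologicalSpace X] (f : X → X) (hf : Continuous f)
    (U₁ U₂ : Set X) (hU₁open : IsOpen U₁) (hU₂open : IsOpen U₂) (hU₁U₂ : U₁ ∩ U₂ = ∅)
    (B : Set X) (hfU₁ : f '' U₁ ⊆ U₁ ∪ B) (hfU₂ : f '' U₂ ⊆ U₂ ∪ B)
    (hfB : f '' B ⊆ B) (hB : B ∩ (U₁ ∪ U₂) = ∅)
    (K : Set X) (hK : IsPreconnected K)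
    (henter : ∀ x ∈ K, ∃ n : ℕ, 1 ≤ n ∧ f^[n] x ∈ U₁ ∪ U₂) :
    (∀ x ∈ K, ∀ n : ℕ, 1 ≤ n → f^[n] x ∉ U₂) ∨
    (∀ x ∈ K, ∀ n : ℕ, 1 ≤ n → f^[n] x ∉ U₁) := by
  have hmaps : ∀ {U : Set X}, f '' U ⊆ U ∪ B → Set.MapsTo f (U ∪ B) (U ∪ B) := fun hfU =>
    (Set.mapsTo_iff_image_subset.2 hfU).union
      ((Set.mapsTo_iff_image_subset.2 hfB).mono_right Set.subset_union_right)
  have hdisj : Disjoint U₁ U₂ := Set.disjoint_iff_inter_eq_empty.2 hU₁U₂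
  obtain ⟨hB₁, hB₂⟩ := Set.disjoint_union_right.1 (Set.disjoint_iff_inter_eq_empty.2 hB)
  by_contra! ⟨⟨x, hxK, m, hm, hx⟩, y, hyK, n, hn, hy⟩
  obtain ⟨z, -, ⟨k, -, hk⟩, l, -, hl⟩ := hK _ _
    (hf.isOpen_setOf_exists_iterate_mem hU₁open) (hf.isOpen_setOf_exists_iterate_mem hU₂open)
    (fun w hw => by
      obtain ⟨j, hj, h | h⟩ := henter w hw
      exacts [Or.inl ⟨j, hj, h⟩, Or.inr ⟨j, hj, h⟩])
    ⟨y, hyK, n, hn, hy⟩ ⟨x, hxK, m, hm, hx⟩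
  rcases le_total k l with hkl | hlk
  · exact (hmaps hfU₁).iterate_notMem_of_le (hdisj.union_left hB₂) hkl (Or.inl hk) hl
  · exact (hmaps hfU₂).iterate_notMem_of_le (hdisj.symm.union_left hB₁) hlk (Or.inl hl) hk
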